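/- Let R be a commutative ring, s ∈ R, and q = s². For every positive integer n, the determinant of the n×n matrix whose (i,j)-entry is s^{(i−j)²} (for 1 ≤ i, j ≤ n) equals the n-th signed bigrassmannian polynomial evaluated at q: det( s^{(i−j)²} )_{i,j=1}^{n} = Σ_{w ∈ S_n} (−1)^{ℓ(w)} q^{β(w)} = ∏_{k=1}^{n−1} (1 − q^k)^{n−k}. -/

import Mathlib

/-- The length ℓ(w) = |N(w)|, the number of inversions of `w`, where
N(w) = {(i,j) : i < j and w⁻¹(i) > w⁻¹(j)}. -/
def permLen {n : ℕ} (w : Equiv.Perm (Fin n)) : ℕ :=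
  (Finset.univ.filter
    (fun p : Fin n × Fin n => p.1 < p.2 ∧ w⁻¹ p.2 < w⁻¹ p.1)).card

/-- The bigrassmannian statistic β(w) = Σ_{(i,j)∈N(w)} (j−i). -/
def permBeta {n : ℕ} (w : Equiv.Perm (Fin n)) : ℕ :=
  ∑ p ∈ Finset.univ.filter
      (fun p : Fin n × Fin n => p.1 < p.2 ∧ w⁻¹ p.2 < w⁻¹ p.1),
    ((p.2 : ℕ) - (p.1 : ℕ))

theorem neg_one_pow_permLen {n : ℕ} (w : Equiv.Perm (Fin n)) :
    (-1 : ℤˣ) ^ permLen w = Equiv.Perm.sign w := by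
  rw [← Equiv.Perm.sign_inv, Equiv.Perm.sign_eq_prod_prod_Iio, permLen, ← Finset.prod_const,
    Finset.prod_filter, Fintype.prod_prod_type_right]
  refine Finset.prod_congr rfl fun j _ => ?_
  rw [← Finset.filter_gt_eq_Iio, Finset.prod_filter]
  refine Finset.prod_congr rfl fun i _ => ?_
  have hinj : w⁻¹ i = w⁻¹ j → i = j := fun h => w⁻¹.injective h
  grind

theorem sum_sign_sub {n : ℕ} (k : Fin n) :
    ∑ i : Fin n, Int.sign ((k : ℤ) - (i : ℤ)) = 2 * (k : ℤ) - (n - 1) := by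
  obtain ⟨k, hk⟩ := k
  induction n with
  | zero => omega
  | succ n ih =>
    rw [Fin.sum_univ_castSucc]
    simp only [Fin.val_castSucc, Fin.val_last] at ih ⊢
    rcases Nat.lt_succ_iff_lt_or_eq.mp hk with h | rfl
    · rw [ih h, Int.sign_eq_neg_one_of_neg (by omega)]
      push_cast
      ring
    · rw [Finset.sum_congr rfl fun i _ => Int.sign_eq_one_of_pos (by omega)]
      simp
      ring

/-- Twice the bigrassmannian statistic is the total squared displacement. -/
theorem sum_sq_displacement {n : ℕ} (w : Equiv.Perm (Fin n)) :
    ∑ i, ((w i : ℤ) - (i : ℤ)).natAbs ^ 2 = 2 * permBeta w := by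
  set u := w⁻¹ with hu
  have hreindex : ∑ i, ((w i : ℤ) - (i : ℤ)) ^ 2 = ∑ j : Fin n, ((j : ℤ) - (u j : ℤ)) ^ 2 := by
    rw [← Equiv.sum_comp u]
    simp [hu]
  have hsq : ∑ j, (u j : ℤ) ^ 2 = ∑ j : Fin n, (j : ℤ) ^ 2 :=
    Equiv.sum_comp u fun j : Fin n => (j : ℤ) ^ 2
  have hsign (v : Equiv.Perm (Fin n)) :
      ∑ j : Fin n, ∑ i : Fin n, ((j : ℤ) - i) * Int.sign ((v j : ℤ) - v i)
        = 2 * ∑ j : Fin n, (j : ℤ) * (2 * (v j : ℤ) - (n - 1)) := by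
    have h1 : ∑ j : Fin n, ∑ i : Fin n, (j : ℤ) * Int.sign ((v j : ℤ) - v i)
        = ∑ j : Fin n, (j : ℤ) * (2 * (v j : ℤ) - (n - 1)) := by
      refine Finset.sum_congr rfl fun j _ => ?_
      rw [← Finset.mul_sum, ← sum_sign_sub,
        Equiv.sum_comp v fun i : Fin n => Int.sign ((v j : ℤ) - i)]
    have h2 : ∑ j : Fin n, ∑ i : Fin n, (i : ℤ) * Int.sign ((v j : ℤ) - v i)
        = -∑ j : Fin n, (j : ℤ) * (2 * (v j : ℤ) - (n - 1)) := by
      rw [Finset.sum_comm, ← h1, ← Finset.sum_neg_distrib]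
      refine Finset.sum_congr rfl fun j _ => ?_
      rw [← Finset.sum_neg_distrib]
      refine Finset.sum_congr rfl fun i _ => ?_
      rw [← neg_sub (v j : ℤ), Int.sign_neg, mul_neg]
    simp only [sub_mul, Finset.sum_sub_distrib] at h1 h2 ⊢
    linarith
  have hbeta : (permBeta w : ℤ) = ∑ j : Fin n, ∑ i : Fin n,
      if i < j ∧ u j < u i then (j : ℤ) - i else 0 := by
    rw [permBeta, Finset.sum_filter, Fintype.sum_prod_type_right]
    push_cast
    refine Finset.sum_congr rfl fun j _ => Finset.sum_congr rfl fun i _ => ?_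
    split_ifs with h
    · exact Nat.cast_sub h.1.le
    · rfl
  have hbeta' : (permBeta w : ℤ) = ∑ j : Fin n, ∑ i : Fin n,
      if j < i ∧ u i < u j then (i : ℤ) - j else 0 := by
    rw [hbeta, Finset.sum_comm]
  have hdiff : ∑ j : Fin n, ∑ i : Fin n, ((j : ℤ) - i) * Int.sign ((j : ℤ) - i)
      - ∑ j : Fin n, ∑ i : Fin n, ((j : ℤ) - i) * Int.sign ((u j : ℤ) - u i)
      = 2 * (permBeta w + permBeta w) := by
    nth_rewrite 1 [hbeta]
    rw [hbeta']
    simp only [← Finset.sum_add_distrib, ← Finset.sum_sub_distrib, Finset.mul_sum]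
    refine Finset.sum_congr rfl fun j _ => Finset.sum_congr rfl fun i _ => ?_
    rcases lt_trichotomy i j with h | rfl | h
    · rw [Int.sign_eq_one_of_pos (by omega : (0 : ℤ) < (j : ℤ) - i)]
      rcases lt_or_gt_of_ne (u.injective.ne h.ne) with h' | h'
      · rw [Int.sign_eq_one_of_pos (by omega : (0 : ℤ) < (u j : ℤ) - u i)]
        simp [h.not_gt, h'.not_gt]
      · rw [Int.sign_eq_neg_one_of_neg (by omega : (u j : ℤ) - u i < 0)]
        simp [h, h', h.not_gt]
        ring
    · simp
    · rw [Int.sign_eq_neg_one_of_neg (by omega : (j : ℤ) - i < 0)]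
      rcases lt_or_gt_of_ne (u.injective.ne h.ne) with h' | h'
      · rw [Int.sign_eq_neg_one_of_neg (by omega : (u j : ℤ) - u i < 0)]
        simp [h.not_gt, h'.not_gt]
      · rw [Int.sign_eq_one_of_pos (by omega : (0 : ℤ) < (u j : ℤ) - u i)]
        simp [h, h', h.not_gt]
        ring
  have hid := hsign 1
  simp only [Equiv.Perm.coe_one, id_eq] at hid
  rw [hid, hsign u] at hdiff
  have hcast : ((∑ i, ((w i : ℤ) - (i : ℤ)).natAbs ^ 2 : ℕ) : ℤ)
      = ∑ i, ((w i : ℤ) - (i : ℤ)) ^ 2 := by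
    rw [Nat.cast_sum]
    exact Finset.sum_congr rfl fun i _ => by rw [Nat.cast_pow, Int.natAbs_sq]
  rw [← Nat.cast_inj (R := ℤ), hcast, hreindex, Nat.cast_mul, Nat.cast_two]
  simp only [sub_sq, Finset.sum_add_distrib, Finset.sum_sub_distrib, hsq]
  simp only [mul_sub, Finset.sum_sub_distrib] at hdiff
  have e1 : ∑ j : Fin n, (j : ℤ) * (2 * (j : ℤ)) = 2 * ∑ j : Fin n, (j : ℤ) ^ 2 := by
    rw [Finset.mul_sum]
    exact Finset.sum_congr rfl fun j _ => by ring
  have e2 : ∑ j : Fin n, (j : ℤ) * (2 * (u j : ℤ)) = ∑ j : Fin n, 2 * (j : ℤ) * (u j : ℤ) :=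
    Finset.sum_congr rfl fun j _ => by ring
  rw [e1, e2] at hdiff
  linarith

theorem det_pow_sq_sub_eq_sum {R : Type*} [CommRing R] (s : R) (n : ℕ) :
    (Matrix.of fun i j : Fin n => s ^ (((i : ℤ) - (j : ℤ)).natAbs ^ 2)).det
      = ∑ w : Equiv.Perm (Fin n), (-1 : R) ^ permLen w * (s ^ 2) ^ permBeta w := by
  rw [Matrix.det_apply']
  refine Finset.sum_congr rfl fun w _ => ?_
  simp only [Matrix.of_apply]
  rw [Finset.prod_pow_eq_pow_sum, sum_sq_displacement, pow_mul, ← neg_one_pow_permLen]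
  simp

theorem prod_Ioi_sub_eq_prod_pow {M : Type*} [CommMonoid M] (f : ℕ → M) (n : ℕ) :
    ∏ i : Fin n, ∏ j ∈ Finset.Ioi i, f (j - i) = ∏ k ∈ Finset.Icc 1 (n - 1), f k ^ (n - k) := by
  induction n with
  | zero => simp
  | succ n ih =>
    rw [Fin.prod_univ_succ, Fin.prod_Ioi_zero]
    simp only [Fin.prod_Ioi_succ, Fin.val_succ, Fin.val_zero, Nat.add_sub_add_right, ih,
      Nat.sub_zero, Nat.add_sub_cancel]
    rw [Fin.prod_univ_eq_prod_range (fun j => f (j + 1)) n]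
    have h1 : ∏ j ∈ Finset.range n, f (j + 1) = ∏ k ∈ Finset.Icc 1 n, f k := by
      rw [Finset.range_eq_Ico, Finset.prod_Ico_add' f 0 n 1]
      rfl
    have h2 : ∏ k ∈ Finset.Icc 1 (n - 1), f k ^ (n - k) = ∏ k ∈ Finset.Icc 1 n, f k ^ (n - k) := by
      refine Finset.prod_subset (Finset.Icc_subset_Icc_right (Nat.sub_le n 1)) fun k hk hk' => ?_
      rw [Finset.mem_Icc] at hk hk'
      rw [show n - k = 0 by omega, pow_zero]
    rw [h1, h2, ← Finset.prod_mul_distrib]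
    refine Finset.prod_congr rfl fun k hk => ?_
    rw [Finset.mem_Icc] at hk
    rw [← pow_succ', Nat.succ_sub hk.2]

theorem det_pow_sq_sub_of_ne_zero {K : Type*} [Field K] {s : K} (hs : s ≠ 0) (n : ℕ) :
    (Matrix.of fun i j : Fin n => s ^ (((i : ℤ) - (j : ℤ)).natAbs ^ 2)).det
      = ∏ k ∈ Finset.Icc 1 (n - 1), (1 - (s ^ 2) ^ k) ^ (n - k) := by
  have hentry : (Matrix.of fun i j : Fin n => s ^ (((i : ℤ) - (j : ℤ)).natAbs ^ 2))
      = Matrix.of fun i j : Fin n => s ^ ((i : ℕ) ^ 2) * (Matrix.of fun i j : Fin n =>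
        s ^ ((j : ℕ) ^ 2) * Matrix.vandermonde (fun i : Fin n => ((s ^ 2) ^ (i : ℕ))⁻¹) i j) i j := by
    ext i j
    simp only [Matrix.of_apply, Matrix.vandermonde_apply]
    rw [inv_pow, ← mul_assoc, eq_mul_inv_iff_mul_eq₀ (by simp [hs]), ← pow_mul, ← pow_mul,
      ← pow_add, ← pow_add]
    congr 1
    zify
    rw [sq_abs]
    ring
  rw [hentry, Matrix.det_mul_column, Matrix.det_mul_row, Matrix.det_vandermonde,
    ← prod_Ioi_sub_eq_prod_pow fun k => 1 - (s ^ 2) ^ k]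
  have hfactor : ∀ i : Fin n, ∀ j ∈ Finset.Ioi i, ((s ^ 2) ^ (j : ℕ))⁻¹ - ((s ^ 2) ^ (i : ℕ))⁻¹
      = ((s ^ 2) ^ (j : ℕ))⁻¹ * (1 - (s ^ 2) ^ ((j : ℕ) - i)) := by
    intro i j hij
    have hle : (i : ℕ) ≤ j := (Finset.mem_Ioi.mp hij).le
    rw [pow_sub₀ _ (pow_ne_zero 2 hs) hle]
    field_simp
  have hinv : ∏ i : Fin n, ∏ j ∈ Finset.Ioi i, ((s ^ 2) ^ (j : ℕ))⁻¹
      = ∏ j : Fin n, ((s ^ ((j : ℕ) ^ 2)) * s ^ ((j : ℕ) ^ 2))⁻¹ := by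
    rw [Finset.prod_comm' (t' := Finset.univ) (s' := fun j => Finset.Iio j) (by simp)]
    refine Finset.prod_congr rfl fun j _ => ?_
    rw [Finset.prod_const, Fin.card_Iio, inv_pow]
    ring
  rw [Finset.prod_congr rfl fun i _ => Finset.prod_congr rfl (hfactor i)]
  simp only [Finset.prod_mul_distrib]
  rw [hinv, ← mul_assoc, ← mul_assoc, ← Finset.prod_mul_distrib, ← Finset.prod_mul_distrib,
    Finset.prod_congr rfl fun j _ => mul_inv_cancel₀ (by simp [hs]), Finset.prod_const_one, one_mul]

theorem map_det_pow_sq_sub {A B : Type*} [CommRing A] [CommRing B] (f : A →+* B) (a : A) (n : ℕ) :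
    f (Matrix.of fun i j : Fin n => a ^ (((i : ℤ) - (j : ℤ)).natAbs ^ 2)).det
      = (Matrix.of fun i j : Fin n => f a ^ (((i : ℤ) - (j : ℤ)).natAbs ^ 2)).det := by
  rw [f.map_det]
  congr 1
  ext i j
  simp

theorem det_pow_sq_sub_eq_prod {R : Type*} [CommRing R] (s : R) (n : ℕ) :
    (Matrix.of fun i j : Fin n => s ^ (((i : ℤ) - (j : ℤ)).natAbs ^ 2)).det
      = ∏ k ∈ Finset.Icc 1 (n - 1), (1 - (s ^ 2) ^ k) ^ (n - k) := by
  have hX : (Matrix.of fun i j : Fin n =>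
      (Polynomial.X : Polynomial ℤ) ^ (((i : ℤ) - (j : ℤ)).natAbs ^ 2)).det
      = ∏ k ∈ Finset.Icc 1 (n - 1), (1 - (Polynomial.X ^ 2) ^ k) ^ (n - k) := by
    have hinj := IsFractionRing.injective (Polynomial ℤ) (FractionRing (Polynomial ℤ))
    apply hinj
    rw [map_det_pow_sq_sub, det_pow_sq_sub_of_ne_zero
      ((map_ne_zero_iff _ hinj).mpr Polynomial.X_ne_zero)]
    simp
  have h := congrArg (Polynomial.eval₂RingHom (Int.castRingHom R) s) hX
  rw [map_det_pow_sq_sub] at h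
  simpa [Polynomial.eval₂_finsetProd, Polynomial.eval₂_pow] using h

/-- for a commutative ring R, s ∈ R, q = s² and n ≥ 1,
det( s^{(i−j)²} )_{i,j=1}^n = Σ_{w ∈ S_n} (−1)^{ℓ(w)} q^{β(w)}
                            = ∏_{k=1}^{n−1} (1 − q^k)^{n−k}. -/
theorem signed_bigrassmannian_stmt11 {R : Type*} [CommRing R] (s q : R)
    (hq : q = s ^ 2) (n : ℕ) (hn : 0 < n) :
    (Matrix.of fun i j : Fin n => s ^ (((i : ℤ) - (j : ℤ)).natAbs ^ 2)).det
        = ∑ w : Equiv.Perm (Fin n), (-1 : R) ^ permLen w * q ^ permBeta w ∧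
    ∑ w : Equiv.Perm (Fin n), (-1 : R) ^ permLen w * q ^ permBeta w
        = ∏ k ∈ Finset.Icc 1 (n - 1), (1 - q ^ k) ^ (n - k) := by
  subst hq
  exact ⟨det_pow_sq_sub_eq_sum s n,
    (det_pow_sq_sub_eq_sum s n).symm.trans (det_pow_sq_sub_eq_prod s n)⟩
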